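/- Cost of smearing charges out: There is a constant C > 0 depending only on ρ and d such that for every μ ∈ L^∞(ℝ^d), every x ∈ ℝ^d and every ℓ > 0, |∫_{ℝ^d} ( w(x − y) − ∫_{ℝ^d} w(z − y) dδ_x^{(ℓ)}(z) ) μ(y) dy | ≤ C ℓ² ‖μ‖_{L^∞}; in other words |D(μ, δ_x − δ_x^{(ℓ)})| ≤ C ℓ² ‖μ‖_{L^∞}. (The integrand is supported in B(x,ℓ) and absolutely integrable, so the left-hand side is well defined.) -/

import Mathlib

open MeasureTheory Metric Real Filter
open scoped Topology ENNReal BigOperators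

noncomputable section

/-- Euclidean space `ℝ^d`. -/
abbrev Euc (d : ℕ) := EuclideanSpace ℝ (Fin d)

/-- The Coulomb kernel `w` : `|x|^{2-d}` for `d ≥ 3`, `-log |x|` for `d = 2`. -/
def ck (d : ℕ) (x : Euc d) : ℝ :=
  if d = 2 then -Real.log ‖x‖ else ‖x‖ ^ ((2 : ℝ) - d)

/-- The smeared Dirac mass `δ_p^{(η)}`: density `ρ_η(x - p)` with `ρ_η(x) = η^{-d} ρ(x/η)`. -/
def smear (d : ℕ) (ρ : Euc d → ℝ) (η : ℝ) (p : Euc d) (x : Euc d) : ℝ :=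
  (η ^ d)⁻¹ * ρ (η⁻¹ • (x - p))

open scoped RealInnerProductSpace

theorem hasDerivAt_line {d : ℕ} (a b : Euc d) (s : ℝ) :
    HasDerivAt (fun s : ℝ => a + s • b) b s := by
  simpa using ((hasDerivAt_id s).smul_const b).const_add a

theorem hasDerivAt_norm_line {d : ℕ} (a b : Euc d) (s : ℝ) (h : a + s • b ≠ 0) :
    HasDerivAt (fun s : ℝ => ‖a + s • b‖) (⟪a + s • b, b⟫ / ‖a + s • b‖) s := by
  have h1 := ((hasDerivAt_line a b s).norm_sq).sqrt (by positivity)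
  simp only [Real.sqrt_sq (norm_nonneg _)] at h1
  refine h1.congr_deriv ?_
  have : ‖a + s • b‖ ≠ 0 := by simpa using h
  field_simp

/-- The constant `c` with `∇ w (x) = - c x / |x|^d`. -/
def coulombConst (d : ℕ) : ℝ := if d = 2 then 1 else (d : ℝ) - 2

theorem coulombConst_nonneg {d : ℕ} (hd : 2 ≤ d) : 0 ≤ coulombConst d := by
  have : (2 : ℝ) ≤ d := by exact_mod_cast hd
  unfold coulombConst
  split_ifs <;> linarith

theorem hasDerivAt_ck_line {d : ℕ} (a b : Euc d) (s : ℝ)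
    (h : a + s • b ≠ 0) :
    HasDerivAt (fun s : ℝ => ck d (a + s • b))
      (-coulombConst d * (⟪a + s • b, b⟫ / ‖a + s • b‖ ^ d)) s := by
  have h0 : ‖a + s • b‖ ≠ 0 := by simpa using h
  have hpos : 0 < ‖a + s • b‖ := by positivity
  have h1 := hasDerivAt_norm_line a b s h
  unfold ck coulombConst
  split_ifs with h2
  · subst h2
    refine (h1.log h0).fun_neg.congr_deriv ?_
    field_simp
  · refine (h1.rpow_const (p := (2 : ℝ) - d) (Or.inl h0)).congr_deriv ?_
    rw [show (2 : ℝ) - d - 1 = 1 - d by ring, Real.rpow_sub hpos, Real.rpow_one, Real.rpow_natCast]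
    field_simp
    ring

theorem hasDerivAt_field_line {d : ℕ} (a b : Euc d) (s : ℝ) (h : a + s • b ≠ 0) :
    HasDerivAt (fun s : ℝ => ⟪a + s • b, b⟫ / ‖a + s • b‖ ^ d)
      (‖b‖ ^ 2 / ‖a + s • b‖ ^ d - d * ⟪a + s • b, b⟫ ^ 2 / ‖a + s • b‖ ^ (d + 2)) s := by
  have h0 : ‖a + s • b‖ ≠ 0 := by simpa using h
  have h1 := hasDerivAt_norm_line a b s h
  have h2 : HasDerivAt (fun s : ℝ => ⟪a + s • b, b⟫) (‖b‖ ^ 2) s := by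
    simpa using (hasDerivAt_line a b s).inner ℝ (hasDerivAt_const s b)
  refine (h2.fun_div (h1.fun_pow d) (pow_ne_zero d h0)).congr_deriv ?_
  rcases d with _ | d
  · simp
  · simp only [Nat.add_sub_cancel]
    field_simp
    ring

theorem measurable_ck (d : ℕ) : Measurable (ck d) := by
  unfold ck
  split_ifs <;> fun_prop

theorem continuousOn_ck (d : ℕ) : ContinuousOn (ck d) {0}ᶜ := by
  unfold ck
  split_ifs
  · exact (continuous_norm.continuousOn.log fun x hx => by simpa using hx).neg
  · exact continuous_norm.continuousOn.rpow_const fun x hx => Or.inl (by simpa using hx)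

theorem ck_neg {d : ℕ} (x : Euc d) : ck d (-x) = ck d x := by simp [ck]

/-- The component along `v` of the field `x / |x|^d`. -/
def field (d : ℕ) (v x : Euc d) : ℝ := ⟪x, v⟫ / ‖x‖ ^ d

/-- The derivative of `field d v` in the direction `v`. -/
def fieldDeriv (d : ℕ) (v x : Euc d) : ℝ :=
  ‖v‖ ^ 2 / ‖x‖ ^ d - d * ⟪x, v⟫ ^ 2 / ‖x‖ ^ (d + 2)

theorem measurable_field {d : ℕ} (v : Euc d) : Measurable (field d v) := by
  unfold field; fun_prop

theorem measurable_fieldDeriv {d : ℕ} (v : Euc d) : Measurable (fieldDeriv d v) := by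
  unfold fieldDeriv; fun_prop

theorem continuousOn_field {d : ℕ} (v : Euc d) : ContinuousOn (field d v) {0}ᶜ := by
  unfold field
  refine ContinuousOn.div (by fun_prop) (by fun_prop) fun x hx => ?_
  exact pow_ne_zero _ (by simpa using hx)

theorem continuousOn_fieldDeriv {d : ℕ} (v : Euc d) : ContinuousOn (fieldDeriv d v) {0}ᶜ := by
  unfold fieldDeriv
  refine ContinuousOn.sub (ContinuousOn.div (by fun_prop) (by fun_prop) fun x hx => ?_)
    (ContinuousOn.div (by fun_prop) (by fun_prop) fun x hx => ?_) <;>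
  exact pow_ne_zero _ (by simpa using hx)

/-- A radial probability density supported in the closed unit ball. -/
structure IsRadialDensity (d : ℕ) (ρ : Euc d → ℝ) : Prop where
  meas : Measurable ρ
  nonneg : ∀ x, 0 ≤ ρ x
  radial : ∀ x y : Euc d, ‖x‖ = ‖y‖ → ρ x = ρ y
  supp : Function.support ρ ⊆ closedBall 0 1
  integral_eq : ∫ x, ρ x = 1

namespace IsRadialDensity

variable {d : ℕ} {ρ : Euc d → ℝ}

theorem integrable (hρ : IsRadialDensity d ρ) : Integrable ρ := by
  by_contra h
  have := hρ.integral_eq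
  rw [integral_undef h] at this
  norm_num at this

theorem norm_le_one (hρ : IsRadialDensity d ρ) {z : Euc d} (hz : ρ z ≠ 0) : ‖z‖ ≤ 1 := by
  simpa using hρ.supp hz

end IsRadialDensity

/-- The potential `∫ k(y - z) ρ(z) dz` generated by `ρ` through the kernel `k`. -/
def pot (d : ℕ) (ρ k : Euc d → ℝ) (y : Euc d) : ℝ := ∫ z, k (y - z) * ρ z

namespace IsRadialDensity

variable {d : ℕ} {ρ : Euc d → ℝ}

/-- Uniform bound for a kernel on the shells seen from near `y` outside the unit ball. -/
theorem exists_kernel_bound (hρ : IsRadialDensity d ρ) {k : Euc d → ℝ}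
    (hc : ContinuousOn k {0}ᶜ) {r R : ℝ} (hr : 1 < r) :
    ∃ C, ∀ y z : Euc d, r ≤ ‖y‖ → ‖y‖ ≤ R → ‖k (y - z) * ρ z‖ ≤ C * ρ z := by
  obtain ⟨C, hC⟩ := ((isCompact_closedBall (0 : Euc d) (R + 1)).diff
    (isOpen_ball (x := (0 : Euc d)) (ε := r - 1))).exists_bound_of_continuousOn
    (hc.mono (by
      rintro x ⟨-, hx⟩ rfl
      exact hx (by simpa using hr)))
  refine ⟨C, fun y z hy hyR => ?_⟩
  rw [norm_mul, Real.norm_of_nonneg (hρ.nonneg z)]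
  by_cases hz : ρ z = 0
  · simp [hz]
  · refine mul_le_mul_of_nonneg_right (hC _ ⟨?_, ?_⟩) (hρ.nonneg z)
    · have := norm_sub_le y z
      have := hρ.norm_le_one hz
      rw [mem_closedBall_zero_iff]; linarith
    · have := norm_sub_norm_le y z
      have := hρ.norm_le_one hz
      rw [mem_ball_zero_iff, not_lt]; linarith

theorem aestronglyMeasurable_kernel (hρ : IsRadialDensity d ρ) {k : Euc d → ℝ}
    (hk : Measurable k) (y : Euc d) :
    AEStronglyMeasurable (fun z => k (y - z) * ρ z) := by
  have := hρ.meas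
  have : Measurable fun z => k (y - z) * ρ z := by fun_prop
  exact this.aestronglyMeasurable

theorem integrable_kernel (hρ : IsRadialDensity d ρ) {k : Euc d → ℝ} (hk : Measurable k)
    (hc : ContinuousOn k {0}ᶜ) {y : Euc d} (hy : 1 < ‖y‖) :
    Integrable fun z => k (y - z) * ρ z := by
  obtain ⟨C, hC⟩ := hρ.exists_kernel_bound hc (R := ‖y‖) hy
  exact (hρ.integrable.const_mul C).mono' (hρ.aestronglyMeasurable_kernel hk y)
    (ae_of_all _ fun z => hC y z le_rfl le_rfl)

theorem hasDerivAt_pot (hρ : IsRadialDensity d ρ) {k k' : Euc d → ℝ} {v : Euc d}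
    (hk : Measurable k) (hc : ContinuousOn k {0}ᶜ)
    (hk' : Measurable k') (hc' : ContinuousOn k' {0}ᶜ)
    (hd : ∀ (a : Euc d) (s : ℝ), a + s • v ≠ 0 →
      HasDerivAt (fun s : ℝ => k (a + s • v)) (k' (a + s • v)) s)
    (y : Euc d) (s₀ : ℝ) (hy : 1 < ‖y + s₀ • v‖) :
    HasDerivAt (fun s : ℝ => pot d ρ k (y + s • v)) (pot d ρ k' (y + s₀ • v)) s₀ := by
  obtain ⟨r, hr1, hr⟩ := exists_between hy
  have hcont : Continuous fun s : ℝ => ‖y + s • v‖ := by fun_prop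
  have hS : {s : ℝ | r < ‖y + s • v‖ ∧ ‖y + s • v‖ < ‖y + s₀ • v‖ + 1} ∈ 𝓝 s₀ :=
    (hcont.continuousAt.eventually (lt_mem_nhds hr)).and
      (hcont.continuousAt.eventually (gt_mem_nhds (lt_add_one _)))
  obtain ⟨C, hC⟩ := hρ.exists_kernel_bound hc' (R := ‖y + s₀ • v‖ + 1) hr1
  refine (hasDerivAt_integral_of_dominated_loc_of_deriv_le (bound := fun z => C * ρ z)
    (F := fun s z => k (y + s • v - z) * ρ z) (F' := fun s z => k' (y + s • v - z) * ρ z) hS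
    (Eventually.of_forall fun s => hρ.aestronglyMeasurable_kernel hk _)
    (hρ.integrable_kernel hk hc hy) (hρ.aestronglyMeasurable_kernel hk' _)
    (ae_of_all _ fun z s hs => hC _ z hs.1.le hs.2.le) (hρ.integrable.const_mul C)
    (ae_of_all _ fun z s hs => ?_)).2
  by_cases hz : ρ z = 0
  · simpa [hz] using hasDerivAt_const s (0 : ℝ)
  · have h1 : y - z + s • v ≠ 0 := by
      intro h0
      have h2 : y + s • v = z := by
        rw [← sub_eq_zero, ← h0]; abel
      have := hρ.norm_le_one hz
      have := hs.1
      rw [h2] at this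
      linarith
    have := (hd (y - z) s h1).mul_const (ρ z)
    simpa only [add_sub_right_comm] using this

theorem pot_isometry (hρ : IsRadialDensity d ρ) (k : Euc d → ℝ) (T : Euc d ≃ₗᵢ[ℝ] Euc d)
    (y : Euc d) : pot d ρ k (T y) = pot d ρ (fun x => k (T x)) y := by
  unfold pot
  rw [← T.measurePreserving.integral_comp T.toHomeomorph.measurableEmbedding]
  refine integral_congr_ae (ae_of_all _ fun z => ?_)
  simp only [map_sub, hρ.radial (T z) z (T.norm_map z)]

theorem pot_field_isometry (hρ : IsRadialDensity d ρ) (T : Euc d ≃ₗᵢ[ℝ] Euc d)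
    (v y : Euc d) : pot d ρ (field d (T v)) (T y) = pot d ρ (field d v) y := by
  rw [hρ.pot_isometry]
  congr 1
  ext x
  simp [field]

theorem pot_field_of_inner_eq_zero (hρ : IsRadialDensity d ρ) {v y : Euc d}
    (h : ⟪y, v⟫ = 0) : pot d ρ (field d v) y = 0 := by
  have h1 := hρ.pot_field_isometry ((ℝ ∙ v)ᗮ.reflection) v y
  rw [Submodule.reflection_orthogonalComplement_singleton_eq_neg,
    Submodule.reflection_mem_subspace_eq_self
      (Submodule.mem_orthogonal_singleton_iff_inner_left.2 h)] at h1
  have h2 : pot d ρ (field d (-v)) y = - pot d ρ (field d v) y := by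
    simp [pot, field, neg_div, integral_neg]
  linarith

/-- The field of a radial density is radial. -/
theorem pot_field_eq (hρ : IsRadialDensity d ρ) {e y : Euc d} (he : ‖e‖ = 1) (hy : 1 < ‖y‖)
    (v : Euc d) :
    pot d ρ (field d v) y = ⟪y, v⟫ / ‖y‖ * pot d ρ (field d e) (‖y‖ • e) := by
  have hy0 : ‖y‖ ≠ 0 := by positivity
  set u : Euc d := ‖y‖⁻¹ • y with hu
  have hu1 : ‖u‖ = 1 := by simp [hu, norm_smul, hy0]
  have hyu : y = ‖y‖ • u := by simp [hu, smul_smul, hy0]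
  set α : ℝ := ⟪y, v⟫ / ‖y‖ with hα
  have hsplit : pot d ρ (field d v) y
      = α * pot d ρ (field d u) y + pot d ρ (field d (v - α • u)) y := by
    unfold pot
    rw [← integral_const_mul, ← integral_add]
    · refine integral_congr_ae (ae_of_all _ fun z => ?_)
      simp only [field, inner_sub_right, inner_smul_right]
      ring
    · exact (hρ.integrable_kernel (measurable_field _) (continuousOn_field _) hy).const_mul _
    · exact hρ.integrable_kernel (measurable_field _) (continuousOn_field _) hy
  rw [hsplit, hρ.pot_field_of_inner_eq_zero (v := v - α • u), add_zero]
  · congr 1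
    have hT := Submodule.reflection_sub (v := u) (w := e) (by rw [hu1, he])
    rw [← hρ.pot_field_isometry ((ℝ ∙ (u - e))ᗮ.reflection) u y, hT]
    conv_lhs => rw [hyu, map_smul, hT]
  · rw [inner_sub_right, inner_smul_right, hu, inner_smul_right, real_inner_self_eq_norm_sq, hα]
    field_simp
    ring

end IsRadialDensity

theorem hasDerivAt_mul_of_continuousAt {g : ℝ → ℝ} (hg : ContinuousAt g 0) :
    HasDerivAt (fun s => s * g s) (g 0) 0 := by
  rw [hasDerivAt_iff_tendsto_slope_zero]
  refine (hg.tendsto.mono_left nhdsWithin_le_nhds).congr' ?_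
  filter_upwards [self_mem_nhdsWithin] with t ht
  have : t ≠ 0 := ht
  simp [this]

theorem sum_fieldDeriv_basis {d : ℕ} {x : Euc d} (hx : x ≠ 0) :
    ∑ j, fieldDeriv d (EuclideanSpace.basisFun (Fin d) ℝ j) x = 0 := by
  have h0 : ‖x‖ ≠ 0 := by simpa using hx
  have h1 := (EuclideanSpace.basisFun (Fin d) ℝ).sum_sq_inner_left x
  simp only [fieldDeriv, Finset.sum_sub_distrib, ← Finset.sum_div, ← Finset.mul_sum, h1,
    OrthonormalBasis.norm_eq_one]
  simp
  field_simp
  ring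

namespace IsRadialDensity

variable {d : ℕ} {ρ : Euc d → ℝ}

theorem hasDerivAt_pot_field (hρ : IsRadialDensity d ρ) (v y : Euc d) (s₀ : ℝ)
    (hy : 1 < ‖y + s₀ • v‖) :
    HasDerivAt (fun s : ℝ => pot d ρ (field d v) (y + s • v))
      (pot d ρ (fieldDeriv d v) (y + s₀ • v)) s₀ :=
  hρ.hasDerivAt_pot (measurable_field v) (continuousOn_field v) (measurable_fieldDeriv v)
    (continuousOn_fieldDeriv v) (fun a s h => hasDerivAt_field_line a v s h) y s₀ hy

/-- The field of `ρ` is divergence free outside the unit ball. -/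
theorem sum_pot_fieldDeriv_basis (hρ : IsRadialDensity d ρ) {y : Euc d} (hy : 1 < ‖y‖) :
    ∑ j, pot d ρ (fieldDeriv d (EuclideanSpace.basisFun (Fin d) ℝ j)) y = 0 := by
  unfold pot
  rw [← integral_finsetSum _ fun j _ =>
    hρ.integrable_kernel (measurable_fieldDeriv _) (continuousOn_fieldDeriv _) hy]
  refine integral_eq_zero_of_ae (ae_of_all _ fun z => ?_)
  simp only [← Finset.sum_mul, Pi.zero_apply]
  by_cases hz : ρ z = 0
  · simp [hz]
  · rw [sum_fieldDeriv_basis, zero_mul]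
    intro h
    have := hρ.norm_le_one hz
    rw [← sub_eq_zero.1 h] at this
    linarith

theorem hasDerivAt_radial_field (hρ : IsRadialDensity d ρ) {e : Euc d} (he : ‖e‖ = 1) {t : ℝ}
    (ht : 1 < t) :
    HasDerivAt (fun s : ℝ => pot d ρ (field d e) (s • e))
      (pot d ρ (fieldDeriv d e) (t • e)) t := by
  have := hρ.hasDerivAt_pot_field e 0 t (by simpa [norm_smul, he] using ht.trans_le (le_abs_self t))
  simpa only [zero_add] using this

theorem pot_fieldDeriv_of_orthogonal (hρ : IsRadialDensity d ρ) {e v : Euc d} (he : ‖e‖ = 1)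
    (hv : ‖v‖ = 1) (hev : ⟪e, v⟫ = 0) {t : ℝ} (ht : 1 < t) :
    pot d ρ (fieldDeriv d v) (t • e) = pot d ρ (field d e) (t • e) / t := by
  have ht0 : 0 < t := by linarith
  have hte : ‖t • e‖ = t := by simp [norm_smul, he, abs_of_pos ht0]
  have h1 := hρ.hasDerivAt_pot_field v (t • e) 0 (by simpa [hte] using ht)
  rw [zero_smul, add_zero] at h1
  set n : ℝ → ℝ := fun s => ‖t • e + s • v‖ with hn
  have hn0 : n 0 = t := by simp [hn, hte]
  have hnc : ContinuousAt n 0 := by fun_prop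
  have hg : ContinuousAt (fun s => pot d ρ (field d e) (n s • e) / n s) 0 := by
    refine ContinuousAt.div ?_ hnc (by rw [hn0]; exact ht0.ne')
    refine ContinuousAt.comp (g := fun s : ℝ => pot d ρ (field d e) (s • e)) ?_ hnc
    rw [hn0]
    exact (hρ.hasDerivAt_radial_field he ht).continuousAt
  have h2 := hasDerivAt_mul_of_continuousAt hg
  simp only [hn0] at h2
  refine h1.unique (h2.congr_of_eventuallyEq ?_)
  have hev1 : ∀ᶠ s in 𝓝 (0 : ℝ), 1 < n s :=
    hnc.eventually (lt_mem_nhds (by rw [hn0]; exact ht))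
  filter_upwards [hev1] with s hs
  rw [hρ.pot_field_eq he hs v, inner_add_left, inner_smul_left, inner_smul_left, hev,
    real_inner_self_eq_norm_sq, hv]
  simp only [hn, conj_trivial, mul_zero, zero_add, one_pow, mul_one]
  ring

theorem pot_fieldDeriv_radial (hρ : IsRadialDensity d ρ) (i : Fin d) {t : ℝ} (ht : 1 < t) :
    pot d ρ (fieldDeriv d (EuclideanSpace.basisFun (Fin d) ℝ i))
        (t • EuclideanSpace.basisFun (Fin d) ℝ i)
      = -((d : ℝ) - 1) *
        (pot d ρ (field d (EuclideanSpace.basisFun (Fin d) ℝ i))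
          (t • EuclideanSpace.basisFun (Fin d) ℝ i) / t) := by
  set b := EuclideanSpace.basisFun (Fin d) ℝ with hb
  have hb1 : ∀ j, ‖b j‖ = 1 := fun j => b.norm_eq_one j
  have hsum := hρ.sum_pot_fieldDeriv_basis (y := t • b i)
    (by rw [norm_smul, hb1, mul_one]; exact ht.trans_le (le_abs_self t))
  rw [← hb, ← Finset.add_sum_erase _ _ (Finset.mem_univ i),
    Finset.sum_congr rfl fun j hj => hρ.pot_fieldDeriv_of_orthogonal (hb1 i) (hb1 j)
      (b.orthonormal.2 (Finset.ne_of_mem_erase hj).symm) ht] at hsum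
  have hd : 1 ≤ d := i.pos
  rw [Finset.sum_const, Finset.card_erase_of_mem (Finset.mem_univ i), Finset.card_univ,
    Fintype.card_fin, nsmul_eq_mul, Nat.cast_sub hd, Nat.cast_one] at hsum
  linarith

theorem abs_field_le {v : Euc d} (hv : ‖v‖ = 1) (hd : 1 ≤ d) (x : Euc d) :
    |field d v x| ≤ (‖x‖ ^ (d - 1))⁻¹ := by
  unfold field
  rw [abs_div, abs_of_nonneg (by positivity : 0 ≤ ‖x‖ ^ d)]
  rcases eq_or_ne x 0 with rfl | hx
  · simp
  have h0 : 0 < ‖x‖ := by positivity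
  rw [div_le_iff₀ (by positivity)]
  have := abs_real_inner_le_norm x v
  rw [hv, mul_one] at this
  refine this.trans_eq ?_
  obtain ⟨n, rfl⟩ := Nat.exists_eq_add_of_le' hd
  simp only [Nat.add_sub_cancel, pow_succ]
  field_simp

theorem tendsto_flux (hρ : IsRadialDensity d ρ) (hd : 1 ≤ d) {e : Euc d} (he : ‖e‖ = 1) :
    Tendsto (fun t : ℝ => t ^ (d - 1) * pot d ρ (field d e) (t • e)) atTop (𝓝 1) := by
  rw [← hρ.integral_eq]
  unfold pot
  simp only [← integral_const_mul]
  refine tendsto_integral_filter_of_dominated_convergence (fun z => 2 ^ (d - 1) * ρ z)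
    (Eventually.of_forall fun t =>
      (hρ.aestronglyMeasurable_kernel (measurable_field e) _).const_mul _) ?_
    (hρ.integrable.const_mul _) (ae_of_all _ fun z => ?_)
  · filter_upwards [eventually_ge_atTop 2] with t ht
    refine ae_of_all _ fun z => ?_
    rw [← mul_assoc, norm_mul, Real.norm_of_nonneg (hρ.nonneg z)]
    by_cases hz : ρ z = 0
    · simp [hz]
    refine mul_le_mul_of_nonneg_right ?_ (hρ.nonneg z)
    have hz1 := hρ.norm_le_one hz
    have h1 := norm_sub_norm_le (t • e) z
    rw [norm_smul, he, mul_one, Real.norm_of_nonneg (by linarith)] at h1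
    have h2 : t / 2 ≤ ‖t • e - z‖ := by linarith
    have h3 := abs_field_le he hd (t • e - z)
    rw [norm_mul, Real.norm_of_nonneg (by positivity), Real.norm_eq_abs]
    calc t ^ (d - 1) * |field d e (t • e - z)|
        ≤ t ^ (d - 1) * ((t / 2) ^ (d - 1))⁻¹ := by
          refine mul_le_mul_of_nonneg_left (h3.trans ?_) (by positivity)
          gcongr
      _ = 2 ^ (d - 1) := by
          rw [← inv_pow, ← mul_pow]
          congr 1
          field_simp
  · have key : Tendsto (fun t : ℝ => field d e (e - t⁻¹ • z)) atTop (𝓝 1) := by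
      have h1 : Tendsto (fun t : ℝ => e - t⁻¹ • z) atTop (𝓝 e) := by
        simpa using ((tendsto_inv_atTop_zero (𝕜 := ℝ)).smul_const z).const_sub e
      have he0 : e ≠ 0 := by rintro rfl; simp at he
      have h2 : ContinuousAt (field d e) e :=
        (continuousOn_field e).continuousAt (isOpen_compl_singleton.mem_nhds he0)
      have h3 := h2.tendsto.comp h1
      have h4 : field d e e = 1 := by simp [field, he]
      rwa [h4] at h3
    have h5 := key.mul_const (ρ z)
    rw [one_mul] at h5
    refine h5.congr' ?_
    filter_upwards [eventually_gt_atTop 0] with t ht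
    rw [← mul_assoc]
    congr 1
    have h6 : t • e - z = t • (e - t⁻¹ • z) := by
      rw [smul_sub, smul_smul, mul_inv_cancel₀ ht.ne', one_smul]
    unfold field
    rw [h6, inner_smul_left, norm_smul, Real.norm_of_nonneg ht.le, mul_pow, conj_trivial,
      ← mul_div_assoc, ← mul_assoc]
    obtain ⟨n, rfl⟩ := Nat.exists_eq_add_of_le' hd
    simp only [Nat.add_sub_cancel]
    rw [← pow_succ, mul_div_mul_left _ _ (by positivity)]

/-- Gauss law: outside the unit ball, `ρ` has the field of a unit point charge. -/
theorem radial_field_eq (hρ : IsRadialDensity d ρ) (i : Fin d) {t : ℝ} (ht : 1 < t) :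
    pot d ρ (field d (EuclideanSpace.basisFun (Fin d) ℝ i))
      (t • EuclideanSpace.basisFun (Fin d) ℝ i) = (t ^ (d - 1))⁻¹ := by
  set e := EuclideanSpace.basisFun (Fin d) ℝ i with he
  have he1 : ‖e‖ = 1 := (EuclideanSpace.basisFun (Fin d) ℝ).norm_eq_one i
  have hd : 1 ≤ d := i.pos
  have hderiv : ∀ s ∈ Set.Ioi (1 : ℝ),
      HasDerivAt (fun t : ℝ => t ^ (d - 1) * pot d ρ (field d e) (t • e)) 0 s := by
    intro s hs
    have hs0 : (0 : ℝ) < s := lt_trans one_pos hs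
    refine ((hasDerivAt_pow (d - 1) s).mul (hρ.hasDerivAt_radial_field he1 hs)).congr_deriv ?_
    rw [he, hρ.pot_fieldDeriv_radial i hs, ← he, Nat.cast_sub hd, Nat.cast_one]
    rcases Nat.exists_eq_add_of_le' hd with ⟨n, rfl⟩
    rcases n with _ | n
    · simp
    · simp only [Nat.add_sub_cancel, Nat.cast_add, Nat.cast_one, pow_succ]
      field_simp
      ring
  have hconst : ∀ s ∈ Set.Ioi (1 : ℝ), s ^ (d - 1) * pot d ρ (field d e) (s • e)
      = t ^ (d - 1) * pot d ρ (field d e) (t • e) := fun s hs =>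
    isOpen_Ioi.is_const_of_deriv_eq_zero isPreconnected_Ioi
      (fun u hu => (hderiv u hu).differentiableAt.differentiableWithinAt)
      (fun u hu => (hderiv u hu).deriv) hs ht
  have hlim : Tendsto (fun t : ℝ => t ^ (d - 1) * pot d ρ (field d e) (t • e)) atTop
      (𝓝 (t ^ (d - 1) * pot d ρ (field d e) (t • e))) :=
    tendsto_const_nhds.congr' ((eventually_gt_atTop 1).mono fun s hs => (hconst s hs).symm)
  have h1 := tendsto_nhds_unique hlim (hρ.tendsto_flux hd he1)
  exact eq_inv_of_mul_eq_one_right h1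

end IsRadialDensity

namespace IsRadialDensity

variable {d : ℕ} {ρ : Euc d → ℝ}

theorem hasDerivAt_pot_ck (hρ : IsRadialDensity d ρ) {e : Euc d} (he : ‖e‖ = 1) {t : ℝ}
    (ht : 1 < t) :
    HasDerivAt (fun s : ℝ => pot d ρ (ck d) (s • e))
      (-coulombConst d * pot d ρ (field d e) (t • e)) t := by
  have h := hρ.hasDerivAt_pot (k := ck d) (k' := fun x => -coulombConst d * field d e x) (v := e)
    (measurable_ck d) (continuousOn_ck d) ((measurable_field e).const_mul _)
    ((continuousOn_field e).const_smul (-coulombConst d)) (fun a s h => hasDerivAt_ck_line a e s h)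
    0 t (by simpa [norm_smul, he] using ht.trans_le (le_abs_self t))
  simp only [zero_add] at h
  refine h.congr_deriv ?_
  simp only [pot, mul_assoc, integral_const_mul]

theorem abs_ck_sub_le (hd : 2 ≤ d) {y z : Euc d} (hz : ‖z‖ ≤ 1) (hy : 2 ≤ ‖y‖) :
    |ck d (y - z) - ck d y| ≤ coulombConst d * (‖y‖ - 1)⁻¹ := by
  have hlow : ∀ s ∈ Set.Icc (0 : ℝ) 1, ‖y‖ - 1 ≤ ‖y + s • (-z)‖ := by
    intro s hs
    have h1 := norm_sub_norm_le y (s • z)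
    have h2 : ‖s • z‖ ≤ 1 := by
      rw [norm_smul, Real.norm_of_nonneg hs.1]
      exact mul_le_one₀ hs.2 (norm_nonneg _) hz
    rw [smul_neg, ← sub_eq_add_neg]
    linarith
  have h := norm_image_sub_le_of_norm_deriv_le_segment_01' (f := fun s : ℝ => ck d (y + s • (-z)))
    (f' := fun s => -coulombConst d * (⟪y + s • (-z), -z⟫ / ‖y + s • (-z)‖ ^ d))
    (C := coulombConst d * (‖y‖ - 1)⁻¹)
    (fun s hs => (hasDerivAt_ck_line y (-z) s (by
      have := hlow s hs
      exact norm_pos_iff.1 (by linarith))).hasDerivWithinAt) (fun s hs => by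
      have h1 := hlow s (Set.Ico_subset_Icc_self hs)
      set x := y + s • (-z)
      rw [norm_mul, norm_neg, Real.norm_of_nonneg (coulombConst_nonneg hd)]
      refine mul_le_mul_of_nonneg_left ?_ (coulombConst_nonneg hd)
      have hx0 : 1 ≤ ‖x‖ := by linarith
      have h2 := norm_inner_le_norm (𝕜 := ℝ) x (-z)
      rw [norm_neg] at h2
      rw [norm_div, norm_pow, norm_norm, div_le_iff₀ (by positivity)]
      calc ‖⟪x, -z⟫‖ ≤ ‖x‖ * 1 := h2.trans (by gcongr)
        _ = ‖x‖⁻¹ * ‖x‖ ^ 2 := by field_simp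
        _ ≤ (‖y‖ - 1)⁻¹ * ‖x‖ ^ d := by
          have h3 : 0 < ‖y‖ - 1 := by linarith
          gcongr)
  simpa [← sub_eq_add_neg] using h

theorem tendsto_pot_ck_sub (hρ : IsRadialDensity d ρ) (hd : 2 ≤ d) {e : Euc d} (he : ‖e‖ = 1) :
    Tendsto (fun t : ℝ => pot d ρ (ck d) (t • e) - ck d (t • e)) atTop (𝓝 0) := by
  have hlim : Tendsto (fun t : ℝ => coulombConst d * (t - 1)⁻¹) atTop (𝓝 0) := by
    have := (tendsto_inv_atTop_zero.comp
      (tendsto_atTop_add_const_right atTop (-1 : ℝ) tendsto_id)).const_mul (coulombConst d)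
    simpa [Function.comp_def, ← sub_eq_add_neg] using this
  refine squeeze_zero_norm' ?_ hlim
  filter_upwards [eventually_ge_atTop 2] with t ht
  have hte : ‖t • e‖ = t := by simp [norm_smul, he]; linarith
  have h1 : pot d ρ (ck d) (t • e) - ck d (t • e)
      = ∫ z, (ck d (t • e - z) - ck d (t • e)) * ρ z := by
    simp only [sub_mul]
    rw [integral_sub (hρ.integrable_kernel (measurable_ck d) (continuousOn_ck d)
      (by rw [hte]; linarith)) (hρ.integrable.const_mul _), integral_const_mul, hρ.integral_eq,
      mul_one, pot]
  rw [h1]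
  refine (norm_integral_le_of_norm_le
    (hρ.integrable.const_mul (coulombConst d * (t - 1)⁻¹)) (ae_of_all _ fun z => ?_)).trans_eq ?_
  · rw [norm_mul, Real.norm_of_nonneg (hρ.nonneg z)]
    by_cases hz : ρ z = 0
    · simp [hz]
    refine mul_le_mul_of_nonneg_right ?_ (hρ.nonneg z)
    have := abs_ck_sub_le hd (hρ.norm_le_one hz) (y := t • e) (by rw [hte]; exact ht)
    rwa [hte] at this
  · rw [integral_const_mul, hρ.integral_eq, mul_one]

theorem ck_congr_norm {x y : Euc d} (h : ‖x‖ = ‖y‖) : ck d x = ck d y := by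
  simp only [ck, h]

/-- **Newton theorem**: outside the unit ball the potential of `ρ` is that of a point charge. -/
theorem pot_ck_eq (hρ : IsRadialDensity d ρ) (hd : 2 ≤ d) {y : Euc d} (hy : 1 < ‖y‖) :
    pot d ρ (ck d) y = ck d y := by
  have i : Fin d := ⟨0, by omega⟩
  set e := EuclideanSpace.basisFun (Fin d) ℝ i with he
  have he1 : ‖e‖ = 1 := (EuclideanSpace.basisFun (Fin d) ℝ).norm_eq_one i
  have hderiv : ∀ s ∈ Set.Ioi (1 : ℝ),
      HasDerivAt (fun t : ℝ => pot d ρ (ck d) (t • e) - ck d (t • e)) 0 s := by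
    intro s hs
    have hs0 : (0 : ℝ) < s := lt_trans one_pos hs
    have hse : ‖s • e‖ = s := by simp [norm_smul, he1, abs_of_pos hs0]
    have h1 := hasDerivAt_ck_line (0 : Euc d) e s
      (by rw [zero_add]; exact norm_pos_iff.1 (by rw [hse]; exact hs0))
    simp only [zero_add] at h1
    refine ((hρ.hasDerivAt_pot_ck he1 hs).fun_sub h1).congr_deriv ?_
    rw [he, hρ.radial_field_eq i hs, ← he, hse, inner_smul_left, real_inner_self_eq_norm_sq, he1]
    obtain ⟨n, rfl⟩ := Nat.exists_eq_add_of_le' (show 1 ≤ d by omega)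
    simp only [Nat.add_sub_cancel, pow_succ, conj_trivial]
    field_simp
    simp
  have hconst : ∀ s ∈ Set.Ioi (1 : ℝ), pot d ρ (ck d) (s • e) - ck d (s • e)
      = pot d ρ (ck d) (‖y‖ • e) - ck d (‖y‖ • e) := fun s hs =>
    isOpen_Ioi.is_const_of_deriv_eq_zero isPreconnected_Ioi
      (fun u hu => (hderiv u hu).differentiableAt.differentiableWithinAt)
      (fun u hu => (hderiv u hu).deriv) hs hy
  have hlim : Tendsto (fun t : ℝ => pot d ρ (ck d) (t • e) - ck d (t • e)) atTop
      (𝓝 (pot d ρ (ck d) (‖y‖ • e) - ck d (‖y‖ • e))) :=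
    tendsto_const_nhds.congr' ((eventually_gt_atTop 1).mono fun s hs => (hconst s hs).symm)
  have h1 := sub_eq_zero.1 (tendsto_nhds_unique hlim (hρ.tendsto_pot_ck_sub hd he1))
  have hn : ‖‖y‖ • e‖ = ‖y‖ := by simp [norm_smul, he1]
  have hT := Submodule.reflection_sub hn
  have h2 := hρ.pot_isometry (ck d) ((ℝ ∙ (‖y‖ • e - y))ᗮ.reflection) (‖y‖ • e)
  rw [hT] at h2
  rw [h2, ← ck_congr_norm hn, ← h1]
  congr 1
  ext x
  exact ck_congr_norm (LinearIsometryEquiv.norm_map _ x)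

end IsRadialDensity

theorem abs_ck_le {d : ℕ} (hd : 2 ≤ d) (x : Euc d) :
    |ck d x| ≤ ‖x‖ + (‖x‖ ^ (d - 1))⁻¹ + 1 := by
  rcases (norm_nonneg x).eq_or_lt with h0 | hpos
  · rw [ck, ← h0]
    have : (0 : ℝ) ≤ (0 ^ (d - 1))⁻¹ := by positivity
    split_ifs with h2
    · simp; positivity
    · have h3 : (2 : ℝ) - d ≠ 0 := fun h => h2 (by exact_mod_cast (sub_eq_zero.1 h).symm)
      rw [Real.zero_rpow h3]; simp; positivity
  unfold ck
  split_ifs with h2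
  · subst h2
    rw [abs_neg]
    have h3 := Real.log_le_sub_one_of_pos hpos
    have h4 := Real.log_le_sub_one_of_pos (inv_pos.2 hpos)
    rw [Real.log_inv] at h4
    have h5 : 0 < ‖x‖⁻¹ := inv_pos.2 hpos
    simp only [Nat.add_one_sub_one, pow_one]
    rw [abs_le]
    constructor <;> linarith
  · rw [abs_of_nonneg (by positivity)]
    have h3 : (0 : ℝ) ≤ (‖x‖ ^ (d - 1))⁻¹ := by positivity
    have h4 : (2 : ℝ) ≤ d := by exact_mod_cast hd
    rcases le_total ‖x‖ 1 with h1 | h1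
    · have : ‖x‖ ^ ((2 : ℝ) - d) ≤ ‖x‖ ^ ((1 : ℝ) - d) :=
        Real.rpow_le_rpow_of_exponent_ge hpos h1 (by linarith)
      have h5 : ‖x‖ ^ ((1 : ℝ) - d) = (‖x‖ ^ (d - 1))⁻¹ := by
        rw [← Real.rpow_natCast, ← Real.rpow_neg hpos.le, Nat.cast_sub (by omega)]
        simp
      linarith
    · have := Real.rpow_le_one_of_one_le_of_nonpos h1 (show (2 : ℝ) - d ≤ 0 by linarith)
      linarith

theorem integrableOn_ck {d : ℕ} (hd : 2 ≤ d) (R : ℝ) : IntegrableOn (ck d) (closedBall 0 R) := by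
  have : Nonempty (Fin d) := ⟨⟨0, by omega⟩⟩
  have hball : volume (closedBall (0 : Euc d) R) < ⊤ := measure_closedBall_lt_top
  have h1 : Integrable (fun x : Euc d =>
      (Set.Iic R).indicator (fun r : ℝ => (r ^ (d - 1))⁻¹) ‖x‖) := by
    rw [integrable_fun_norm_addHaar volume (f := (Set.Iic R).indicator fun r : ℝ => (r ^ (d - 1))⁻¹)]
    rw [finrank_euclideanSpace_fin]
    have h2 : IntegrableOn ((Set.Ioc (0 : ℝ) R).indicator fun _ => (1 : ℝ)) (Set.Ioi 0) := by
      refine Integrable.integrableOn ?_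
      rw [integrable_indicator_iff measurableSet_Ioc]
      exact integrableOn_const (by simp)
    refine h2.congr_fun (fun r hr => ?_) measurableSet_Ioi
    have hr0 : (0 : ℝ) < r := hr
    by_cases hrR : r ≤ R
    · simp [Set.indicator, hr0, hrR, hr0.ne']
    · simp [Set.indicator, hrR]
  have h2 : IntegrableOn (fun x : Euc d => (‖x‖ ^ (d - 1))⁻¹) (closedBall 0 R) :=
    h1.integrableOn.congr_fun (fun x hx => by
      have : ‖x‖ ≤ R := by simpa using hx
      simp [Set.indicator, this]) measurableSet_closedBall
  have h3 : IntegrableOn (fun x : Euc d => ‖x‖ + (‖x‖ ^ (d - 1))⁻¹ + 1) (closedBall 0 R) :=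
    ((continuous_norm.continuousOn.integrableOn_compact (isCompact_closedBall _ _)).add h2).add
      (integrableOn_const hball.ne)
  exact h3.mono' (measurable_ck d).aestronglyMeasurable (ae_of_all _ fun x => abs_ck_le hd x)

namespace IsRadialDensity

variable {d : ℕ} {ρ : Euc d → ℝ}

theorem integrable_prod_kernel (hρ : IsRadialDensity d ρ) (hd : 2 ≤ d) (R : ℝ) :
    Integrable (fun p : Euc d × Euc d => ck d (p.1 - p.2) * ρ p.2)
      ((volume.restrict (closedBall 0 R)).prod volume) := by
  have h1 := hρ.integrable.convolution_integrand (ContinuousLinearMap.mul ℝ ℝ)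
    ((integrable_indicator_iff measurableSet_closedBall).2 (integrableOn_ck hd (R + 1)))
  have h2 := h1.mono_measure (Measure.prod_mono Measure.restrict_le_self le_rfl :
    ((volume.restrict (closedBall (0 : Euc d) R)).prod volume) ≤ volume.prod volume)
  refine h2.congr ?_
  have h3 : ∀ᵐ p : Euc d × Euc d ∂((volume.restrict (closedBall 0 R)).prod volume),
      p.1 ∈ closedBall (0 : Euc d) R :=
    Measure.quasiMeasurePreserving_fst.ae (ae_restrict_mem measurableSet_closedBall)
  filter_upwards [h3] with p hp
  by_cases hz : ρ p.2 = 0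
  · simp [hz]
  have hp1 : ‖p.1‖ ≤ R := by simpa using hp
  have hmem : p.1 - p.2 ∈ closedBall (0 : Euc d) (R + 1) := by
    rw [mem_closedBall_zero_iff]
    exact (norm_sub_le _ _).trans (add_le_add hp1 (hρ.norm_le_one hz))
  simp [Set.indicator_of_mem hmem, mul_comm]

theorem ae_integrable_kernel (hρ : IsRadialDensity d ρ) (hd : 2 ≤ d) :
    ∀ᵐ y : Euc d, Integrable fun z => ck d (y - z) * ρ z := by
  have h1 := (ae_restrict_iff' measurableSet_closedBall).1
    (hρ.integrable_prod_kernel hd 1).prod_right_ae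
  filter_upwards [h1] with y hy
  rcases le_or_gt ‖y‖ 1 with h | h
  · exact hy (by simpa using h)
  · exact hρ.integrable_kernel (measurable_ck d) (continuousOn_ck d) h

theorem integrable_ck_sub_pot (hρ : IsRadialDensity d ρ) (hd : 2 ≤ d) :
    Integrable fun y => ck d y - pot d ρ (ck d) y := by
  have h1 : IntegrableOn (fun y => ck d y - pot d ρ (ck d) y) (closedBall 0 1) :=
    (integrableOn_ck hd 1).sub (hρ.integrable_prod_kernel hd 1).integral_prod_left
  refine (integrableOn_iff_integrable_of_support_subset fun y hy => ?_).1 h1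
  by_contra h
  exact hy (sub_eq_zero.2 (hρ.pot_ck_eq hd (by simpa using h)).symm)

end IsRadialDensity

theorem integral_eq_integral_add_smul {d : ℕ} (f : Euc d → ℝ) (x : Euc d) {ℓ : ℝ} (hℓ : 0 < ℓ) :
    ∫ y, f y = ℓ ^ d * ∫ u, f (x + ℓ • u) := by
  rw [Measure.integral_comp_smul volume (fun y => f (x + y)), integral_add_left_eq_self f x,
    finrank_euclideanSpace_fin, abs_of_pos (by positivity), smul_eq_mul,
    mul_inv_cancel_left₀ (by positivity)]

/-- The additive constant in the scaling relation of the Coulomb kernel. -/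
def ckShift (d : ℕ) (ℓ : ℝ) : ℝ := if d = 2 then -Real.log ℓ else 0

theorem ck_smul {d : ℕ} (hd : 2 ≤ d) {ℓ : ℝ} (hℓ : 0 < ℓ) {x : Euc d} (hx : x ≠ 0) :
    ck d (ℓ • x) = ℓ ^ 2 / ℓ ^ d * ck d x + ckShift d ℓ := by
  have hx0 : ‖x‖ ≠ 0 := by simpa using hx
  unfold ck ckShift
  rw [norm_smul, Real.norm_of_nonneg hℓ.le]
  split_ifs with h
  · subst h
    rw [Real.log_mul hℓ.ne' hx0]
    field_simp
    ring
  · rw [Real.mul_rpow hℓ.le (norm_nonneg _), Real.rpow_sub hℓ 2 d, Real.rpow_natCast, add_zero]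
    norm_num

theorem IsRadialDensity.smeared_potential {d : ℕ} {ρ : Euc d → ℝ} (hρ : IsRadialDensity d ρ)
    (hd : 2 ≤ d) (x : Euc d) {ℓ : ℝ} (hℓ : 0 < ℓ) {u : Euc d}
    (hu : Integrable fun z => ck d (u - z) * ρ z) :
    ∫ z, ck d (z - (x + ℓ • u)) * smear d ρ ℓ x z
      = ℓ ^ 2 / ℓ ^ d * pot d ρ (ck d) u + ckShift d ℓ := by
  have : Nonempty (Fin d) := ⟨⟨0, by omega⟩⟩
  rw [integral_eq_integral_add_smul _ x hℓ, ← integral_const_mul]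
  have h1 : ∀ᵐ z : Euc d, z ≠ u := by
    simp [ae_iff]
  have h2 : ∫ z, ((ℓ ^ 2 / ℓ ^ d) * (ck d (u - z) * ρ z) + ckShift d ℓ * ρ z)
      = ℓ ^ 2 / ℓ ^ d * pot d ρ (ck d) u + ckShift d ℓ := by
    rw [integral_add (hu.const_mul _) (hρ.integrable.const_mul _), integral_const_mul,
      integral_const_mul, hρ.integral_eq, mul_one, pot]
  rw [← h2]
  refine integral_congr_ae ?_
  filter_upwards [h1] with z hz
  have h3 : x + ℓ • z - (x + ℓ • u) = -(ℓ • (u - z)) := by rw [smul_sub]; abel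
  simp only [smear, h3, ck_neg, ck_smul hd hℓ (sub_ne_zero.2 hz.symm), add_sub_cancel_left,
    smul_smul, inv_mul_cancel₀ hℓ.ne', one_smul]
  have : ℓ ^ d ≠ 0 := by positivity
  field_simp

/-- **The cost of smearing charges out.** There is a constant `C > 0` depending only on `ρ`
and `d` such that for every bounded measurable `μ`, every `x ∈ ℝ^d` and every `ℓ > 0`,
`|∫ (w(x−y) − (w*δ_x^{(ℓ)})(y)) μ(y) dy| ≤ C ℓ² ‖μ‖_∞`, i.e.
`|D(μ, δ_x − δ_x^{(ℓ)})| ≤ C ℓ² ‖μ‖_∞`. -/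
theorem cost_of_smearing
    (d : ℕ) (hd : 2 ≤ d)
    -- the fixed radial smearing function ρ
    (ρ : Euc d → ℝ) (hρmeas : Measurable ρ) (hρnonneg : ∀ x, 0 ≤ ρ x)
    (hρradial : ∀ x y : Euc d, ‖x‖ = ‖y‖ → ρ x = ρ y)
    (hρsupp : Function.support ρ ⊆ closedBall 0 1)
    (hρint : ∫ x, ρ x = 1) :
    ∃ C : ℝ, 0 < C ∧
      ∀ (μ : Euc d → ℝ), Measurable μ →
        ∀ M : ℝ, (∀ y, |μ y| ≤ M) →
          ∀ (x : Euc d) (ℓ : ℝ), 0 < ℓ →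
            |∫ y, (ck d (x - y) - ∫ z, ck d (z - y) * smear d ρ ℓ x z) * μ y|
              ≤ C * ℓ ^ 2 * M := by
  have hρ : IsRadialDensity d ρ := ⟨hρmeas, hρnonneg, hρradial, hρsupp, hρint⟩
  have : Nonempty (Fin d) := ⟨⟨0, by omega⟩⟩
  set U : Euc d → ℝ := fun y => ck d y - pot d ρ (ck d) y with hU
  have hUint : Integrable U := hρ.integrable_ck_sub_pot hd
  have hU0 : 0 ≤ ∫ u, ‖U u‖ := integral_nonneg fun _ => norm_nonneg _
  refine ⟨(∫ u, ‖U u‖) + 1, by positivity, fun μ _ M hM x ℓ hℓ => ?_⟩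
  have hM0 : 0 ≤ M := (abs_nonneg _).trans (hM 0)
  rw [integral_eq_integral_add_smul _ x hℓ]
  have h0 : ∀ᵐ u : Euc d, u ≠ 0 := by simp [ae_iff]
  have h1 : (∫ u, (ck d (x - (x + ℓ • u)) - ∫ z, ck d (z - (x + ℓ • u)) * smear d ρ ℓ x z)
        * μ (x + ℓ • u))
      = ℓ ^ 2 / ℓ ^ d * ∫ u, U u * μ (x + ℓ • u) := by
    rw [← integral_const_mul]
    refine integral_congr_ae ?_
    filter_upwards [h0, hρ.ae_integrable_kernel hd] with u hu hint
    have h2 : x - (x + ℓ • u) = -(ℓ • u) := by abel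
    simp only [hρ.smeared_potential hd x hℓ hint, h2, ck_neg, ck_smul hd hℓ hu, hU]
    ring
  rw [h1, ← mul_assoc, mul_div_cancel₀ _ (by positivity), abs_mul, abs_of_pos (by positivity)]
  have h3 : |∫ u, U u * μ (x + ℓ • u)| ≤ (∫ u, ‖U u‖) * M := by
    rw [← integral_mul_const]
    refine norm_integral_le_of_norm_le (f := fun u => U u * μ (x + ℓ • u))
      (hUint.norm.mul_const M) (ae_of_all _ fun u => ?_)
    rw [norm_mul]
    exact mul_le_mul_of_nonneg_left (hM _) (norm_nonneg _)
  calc ℓ ^ 2 * |∫ u, U u * μ (x + ℓ • u)| ≤ ℓ ^ 2 * ((∫ u, ‖U u‖) * M) := by gcongr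
    _ ≤ ((∫ u, ‖U u‖) + 1) * ℓ ^ 2 * M := by nlinarith [mul_nonneg (sq_nonneg ℓ) hM0]
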